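/- In the Euclidean space ℝ⁸ with standard orthonormal basis e₁, …, e₈, let R(E₈) be the set of all vectors ±eᵢ ± eⱼ (1 ≤ i < j ≤ 8) together with all ½ Σᵢ₌₁⁸ εᵢ eᵢ with εᵢ ∈ {1, −1} and ε₁ ⋯ ε₈ = 1; set α₀ := ½(e₁ + ⋯ + e₈) and v := e₁ + e₂ + e₃ + e₄ − e₅ − e₆ − e₇ − e₈, and define f₁ = ½(e₁+e₂−e₃−e₄), f₂ = ½(e₁−e₂+e₃−e₄), f₃ = ½(e₁−e₂−e₃+e₄), f₄ = ½(e₅+e₆−e₇−e₈), f₅ = ½(e₅−e₆+e₇−e₈), f₆ = ½(e₅−e₆−e₇+e₈). Then {α ∈ R(E₈) : ⟨α, α₀⟩ = 0 and ⟨α, v⟩ = 0} = {σ fᵢ + τ fⱼ : 1 ≤ i < j ≤ 6, σ, τ ∈ {1, −1}}. -/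

import Mathlib

open scoped InnerProductSpace

noncomputable section

/-- The standard orthonormal basis vectors `e₁, …, e₈` of `ℝ⁸` (`0`-indexed). -/
def e (i : Fin 8) : EuclideanSpace ℝ (Fin 8) := EuclideanSpace.single i (1 : ℝ)

/-- `α₀ = ½(e₁ + ⋯ + e₈)`. -/
def α₀ : EuclideanSpace ℝ (Fin 8) := (1 / 2 : ℝ) • ∑ i, e i

/-- `v = e₁ + e₂ + e₃ + e₄ − e₅ − e₆ − e₇ − e₈`. -/
def v : EuclideanSpace ℝ (Fin 8) := e 0 + e 1 + e 2 + e 3 - e 4 - e 5 - e 6 - e 7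

/-- A sign `ε ∈ {1, −1}`. -/
def IsSign (s : ℝ) : Prop := s = 1 ∨ s = -1

/-- The root system of `E₈`: the vectors `±eᵢ ± eⱼ` (`i < j`) together with the vectors
`½ Σ εᵢ eᵢ` with `εᵢ = ±1` and `ε₁ ⋯ ε₈ = 1`. -/
def RE8 : Set (EuclideanSpace ℝ (Fin 8)) :=
  {α | ∃ i j : Fin 8, i < j ∧ ∃ s t : ℝ, IsSign s ∧ IsSign t ∧ α = s • e i + t • e j} ∪
  {α | ∃ ε : Fin 8 → ℝ, (∀ i, IsSign (ε i)) ∧ (∏ i, ε i) = 1 ∧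
        α = (1 / 2 : ℝ) • ∑ i, ε i • e i}

/-- The vectors `f₁, …, f₆` (`0`-indexed). -/
def f : Fin 6 → EuclideanSpace ℝ (Fin 8)
  | 0 => (1 / 2 : ℝ) • (e 0 + e 1 - e 2 - e 3)
  | 1 => (1 / 2 : ℝ) • (e 0 - e 1 + e 2 - e 3)
  | 2 => (1 / 2 : ℝ) • (e 0 - e 1 - e 2 + e 3)
  | 3 => (1 / 2 : ℝ) • (e 4 + e 5 - e 6 - e 7)
  | 4 => (1 / 2 : ℝ) • (e 4 - e 5 + e 6 - e 7)
  | 5 => (1 / 2 : ℝ) • (e 4 - e 5 - e 6 + e 7)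

/-- `f₇ = e₁ + e₂ + e₃ + e₄ − e₅ − e₆ − e₇ − e₈`. -/
def f₇ : EuclideanSpace ℝ (Fin 8) := e 0 + e 1 + e 2 + e 3 - e 4 - e 5 - e 6 - e 7

/-- The vector of `ℝ⁸` with coordinates `z k / 2`. -/
def halfVector (z : Fin 8 → ℤ) : EuclideanSpace ℝ (Fin 8) :=
  WithLp.toLp 2 fun k => (z k : ℝ) / 2

/-- Twice the coordinates of the vector `f i`. -/
def doubledF : Fin 6 → Fin 8 → ℤ :=
  ![![1, 1, -1, -1, 0, 0, 0, 0], ![1, -1, 1, -1, 0, 0, 0, 0], ![1, -1, -1, 1, 0, 0, 0, 0],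
    ![0, 0, 0, 0, 1, 1, -1, -1], ![0, 0, 0, 0, 1, -1, 1, -1], ![0, 0, 0, 0, 1, -1, -1, 1]]

/-- Orthogonality to `α₀` and `v`: both blocks of four coordinates have sum zero. -/
def BlockSumsZero (z : Fin 8 → ℤ) : Prop :=
  z 0 + z 1 + z 2 + z 3 = 0 ∧ z 4 + z 5 + z 6 + z 7 = 0

instance : DecidablePred BlockSumsZero := fun _ => inferInstanceAs (Decidable (_ ∧ _))

/-- Twice the coordinates of a vector `± eᵢ ± eⱼ`. -/
def IsDoubledPair (z : Fin 8 → ℤ) : Prop :=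
  ∃ i j : Fin 8, i < j ∧ ∃ s t : ℤˣ, z = Pi.single i (2 * (s : ℤ)) + Pi.single j (2 * (t : ℤ))

instance : DecidablePred IsDoubledPair := fun _ => inferInstanceAs (Decidable (∃ _, _))

/-- Twice the coordinates of a vector `σ fᵢ + τ fⱼ`. -/
def IsDoubledD6 (z : Fin 8 → ℤ) : Prop :=
  ∃ i j : Fin 6, i < j ∧ ∃ σ τ : ℤˣ, z = (σ : ℤ) • doubledF i + (τ : ℤ) • doubledF j

instance : DecidablePred IsDoubledD6 := fun _ => inferInstanceAs (Decidable (∃ _, _))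

theorem isDoubledD6_of_pair : ∀ i j : Fin 8, i < j → ∀ s t : ℤˣ,
    BlockSumsZero (Pi.single i (2 * (s : ℤ)) + Pi.single j (2 * (t : ℤ))) →
      IsDoubledD6 (Pi.single i (2 * (s : ℤ)) + Pi.single j (2 * (t : ℤ))) := by
  decide +kernel

theorem isDoubledD6_of_signs : ∀ ε : Fin 8 → ℤˣ,
    BlockSumsZero (fun k => (ε k : ℤ)) → IsDoubledD6 (fun k => (ε k : ℤ)) := by
  decide +kernel

theorem blockSumsZero_and_root_of_D6 : ∀ i j : Fin 6, i < j → ∀ σ τ : ℤˣ,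
    BlockSumsZero ((σ : ℤ) • doubledF i + (τ : ℤ) • doubledF j) ∧
      (IsDoubledPair ((σ : ℤ) • doubledF i + (τ : ℤ) • doubledF j) ∨
        (∀ k, ((σ : ℤ) • doubledF i + (τ : ℤ) • doubledF j) k = 1 ∨
          ((σ : ℤ) • doubledF i + (τ : ℤ) • doubledF j) k = -1) ∧
        ∏ k, ((σ : ℤ) • doubledF i + (τ : ℤ) • doubledF j) k = 1) := by
  decide +kernel

theorem isSign_iff_exists_units {s : ℝ} : IsSign s ↔ ∃ u : ℤˣ, s = ((u : ℤ) : ℝ) := by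
  constructor
  · rintro (rfl | rfl)
    · exact ⟨1, by simp⟩
    · exact ⟨-1, by simp⟩
  · rintro ⟨u, rfl⟩
    rcases Int.units_eq_one_or u with rfl | rfl <;> simp [IsSign]

theorem smul_e_add_smul_e (i j : Fin 8) (s t : ℤ) :
    (s : ℝ) • e i + (t : ℝ) • e j = halfVector (Pi.single i (2 * s) + Pi.single j (2 * t)) := by
  ext k
  simp only [e, halfVector, PiLp.add_apply, PiLp.smul_apply, PiLp.single_apply, Pi.add_apply,
    Pi.single_apply, smul_eq_mul]
  split_ifs <;> push_cast <;> ring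

theorem half_smul_sum_e (z : Fin 8 → ℤ) :
    (1 / 2 : ℝ) • ∑ i, (z i : ℝ) • e i = halfVector z := by
  ext k
  simp [e, halfVector, Pi.single_apply, div_eq_inv_mul]

theorem f_eq_halfVector (i : Fin 6) : f i = halfVector (doubledF i) := by
  ext k
  fin_cases i <;> fin_cases k <;>
    simp [f, e, halfVector, doubledF] <;> norm_num

theorem smul_f_add_smul_f (i j : Fin 6) (s t : ℤ) :
    (s : ℝ) • f i + (t : ℝ) • f j = halfVector (s • doubledF i + t • doubledF j) := by
  ext k
  simp only [f_eq_halfVector, halfVector, PiLp.add_apply, PiLp.smul_apply, Pi.add_apply,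
    Pi.smul_apply, smul_eq_mul]
  push_cast
  ring

theorem inner_halfVector_eq_zero_iff (z : Fin 8 → ℤ) :
    ⟪halfVector z, α₀⟫_ℝ = 0 ∧ ⟪halfVector z, v⟫_ℝ = 0 ↔ BlockSumsZero z := by
  have h₀ : ⟪halfVector z, α₀⟫_ℝ =
      ((z 0 + z 1 + z 2 + z 3 + (z 4 + z 5 + z 6 + z 7) : ℤ) : ℝ) / 4 := by
    simp [α₀, e, halfVector, inner_smul_right, inner_add_right, Fin.sum_univ_eight,
      EuclideanSpace.inner_single_right]
    ring
  have h₁ : ⟪halfVector z, v⟫_ℝ =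
      ((z 0 + z 1 + z 2 + z 3 - (z 4 + z 5 + z 6 + z 7) : ℤ) : ℝ) / 2 := by
    simp [v, e, halfVector, inner_add_right, inner_sub_right,
      EuclideanSpace.inner_single_right]
    ring
  rw [h₀, h₁, div_eq_zero_iff, div_eq_zero_iff, Int.cast_eq_zero, Int.cast_eq_zero]
  norm_num [BlockSumsZero]
  lia

/-- The set of roots of `E₈` orthogonal to both `α₀` and `v` is exactly
`{σ fᵢ + τ fⱼ : 1 ≤ i < j ≤ 6, σ, τ = ±1}`, the root system of `D₆`. -/
theorem roots_orthogonal_eq_D6 :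
    {α ∈ RE8 | ⟪α, α₀⟫_ℝ = 0 ∧ ⟪α, v⟫_ℝ = 0} =
      {α | ∃ i j : Fin 6, i < j ∧
            ∃ σ τ : ℝ, IsSign σ ∧ IsSign τ ∧ α = σ • f i + τ • f j} := by
  ext α
  constructor
  · rintro ⟨⟨i, j, hij, s, t, hs, ht, rfl⟩ | ⟨ε, hε, -, rfl⟩, horth⟩
    · obtain ⟨s, rfl⟩ := isSign_iff_exists_units.1 hs
      obtain ⟨t, rfl⟩ := isSign_iff_exists_units.1 ht
      rw [smul_e_add_smul_e, inner_halfVector_eq_zero_iff] at horth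
      obtain ⟨k, l, hkl, σ, τ, h⟩ := isDoubledD6_of_pair i j hij s t horth
      refine ⟨k, l, hkl, (σ : ℤ), (τ : ℤ), isSign_iff_exists_units.2 ⟨σ, rfl⟩,
        isSign_iff_exists_units.2 ⟨τ, rfl⟩, ?_⟩
      rw [smul_e_add_smul_e, smul_f_add_smul_f, h]
    · choose u hu using fun i => isSign_iff_exists_units.1 (hε i)
      obtain rfl : ε = fun i => ((u i : ℤ) : ℝ) := funext hu
      rw [half_smul_sum_e fun i => (u i : ℤ), inner_halfVector_eq_zero_iff] at horth
      obtain ⟨k, l, hkl, σ, τ, h⟩ := isDoubledD6_of_signs u horth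
      refine ⟨k, l, hkl, (σ : ℤ), (τ : ℤ), isSign_iff_exists_units.2 ⟨σ, rfl⟩,
        isSign_iff_exists_units.2 ⟨τ, rfl⟩, ?_⟩
      rw [half_smul_sum_e fun i => (u i : ℤ), smul_f_add_smul_f, h]
  · rintro ⟨i, j, hij, σ, τ, hσ, hτ, rfl⟩
    obtain ⟨σ, rfl⟩ := isSign_iff_exists_units.1 hσ
    obtain ⟨τ, rfl⟩ := isSign_iff_exists_units.1 hτ
    rw [smul_f_add_smul_f]
    obtain ⟨hsum, hroot⟩ := blockSumsZero_and_root_of_D6 i j hij σ τ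
    refine ⟨?_, (inner_halfVector_eq_zero_iff _).2 hsum⟩
    rcases hroot with ⟨k, l, hkl, s, t, h⟩ | ⟨hsign, hprod⟩
    · refine Or.inl ⟨k, l, hkl, (s : ℤ), (t : ℤ), isSign_iff_exists_units.2 ⟨s, rfl⟩,
        isSign_iff_exists_units.2 ⟨t, rfl⟩, ?_⟩
      rw [h, smul_e_add_smul_e]
    · exact Or.inr ⟨_, fun k => (hsign k).imp (fun h => by rw [h, Int.cast_one])
        (fun h => by rw [h, Int.cast_neg, Int.cast_one]), by exact_mod_cast hprod,
        (half_smul_sum_e _).symm⟩
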